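/- arXiv:1808.08478 — 2 statements merged into one kernel-verified Lean document; each statement's English description precedes it below -/
import Mathlib

section
/- Joint concavity of the E-step objective: let n ≥ 1 and let R_i ≥ 0 (i = 1,…,n), V_{ij} ≥ 0 and D^1_{ij}, D^2_{ij}, D^3_{ij}, D^4_{ij}, D^5_{ij}, D^6_{ij} ≥ 0 (i,j = 1,…,n) be fixed nonnegative reals. Then the function Q(α, β, γ, u, θ) = Σ_i R_i [u_i − log Σ_k exp(u_k)] + Σ_i V_{ii}[u_i + α − log Σ_k exp(u_k + α·1{k=i})] + Σ_i Σ_{j≠i} V_{ij}[u_i − log Σ_k exp(u_k + α·1{k=j})] + Σ_{i,j} [D^1_{ij}(θ_{ij} − log(1+e^{θ_{ij}})) − D^2_{ij} log(1+e^{θ_{ij}}) + D^3_{ij}(θ_{ij}+β − log(1+e^{θ_{ij}+β})) − D^4_{ij} log(1+e^{θ_{ij}+β}) + D^5_{ij}(θ_{ij}+γ − log(1+e^{θ_{ij}+γ})) − D^6_{ij} log(1+e^{θ_{ij}+γ})] is concave as a function of (α, β, γ, u, θ) ∈ ℝ × ℝ × ℝ × ℝ^n × ℝ^{n×n}. -/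
open Finset Real

/-- The E-step objective `Q(α,β,γ,u,θ)` of the temporal-dependent hub model. -/
noncomputable def Qfun {n : ℕ} (R : Fin n → ℝ) (V D1 D2 D3 D4 D5 D6 : Fin n → Fin n → ℝ)
    (p : ℝ × ℝ × ℝ × (Fin n → ℝ) × (Fin n → Fin n → ℝ)) : ℝ :=
  let α := p.1; let β := p.2.1; let γ := p.2.2.1; let u := p.2.2.2.1; let θ := p.2.2.2.2
  (∑ i, R i * (u i - Real.log (∑ k, Real.exp (u k)))) +
  (∑ i, V i i * (u i + α - Real.log (∑ k, Real.exp (u k + if k = i then α else 0)))) +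
  (∑ i, ∑ j ∈ Finset.univ.filter (fun j => j ≠ i),
    V i j * (u i - Real.log (∑ k, Real.exp (u k + if k = j then α else 0)))) +
  ∑ i, ∑ j,
    (D1 i j * (θ i j - Real.log (1 + Real.exp (θ i j))) -
      D2 i j * Real.log (1 + Real.exp (θ i j)) +
      D3 i j * (θ i j + β - Real.log (1 + Real.exp (θ i j + β))) -
      D4 i j * Real.log (1 + Real.exp (θ i j + β)) +
      D5 i j * (θ i j + γ - Real.log (1 + Real.exp (θ i j + γ))) -
      D6 i j * Real.log (1 + Real.exp (θ i j + γ)))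

section LogSumExp

variable {E : Type*} [AddCommGroup E] [Module ℝ E] {s : Set E}

/-- The logarithm of a nonempty finite sum of exponentials of convex functions is convex. -/
theorem ConvexOn.log_sum_exp {ι : Type*} {t : Finset ι} (ht : t.Nonempty) {f : ι → E → ℝ}
    (hs : Convex ℝ s) (hf : ∀ k ∈ t, ConvexOn ℝ s (f k)) :
    ConvexOn ℝ s fun x => Real.log (∑ k ∈ t, Real.exp (f k x)) := by
  refine ⟨hs, fun x hx y hy a b ha hb hab => ?_⟩
  have hpos (z : E) : 0 < ∑ k ∈ t, Real.exp (f k z) :=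
    Finset.sum_pos (fun k _ => Real.exp_pos _) ht
  set A := Real.log (∑ k ∈ t, Real.exp (f k x))
  set B := Real.log (∑ k ∈ t, Real.exp (f k y))
  have hsum (z : E) :
      ∑ k ∈ t, Real.exp (f k z - Real.log (∑ k ∈ t, Real.exp (f k z))) = 1 := by
    simp_rw [Real.exp_sub, Real.exp_log (hpos z), ← Finset.sum_div]
    exact div_self (hpos z).ne'
  have hterm : ∀ k ∈ t, Real.exp (f k (a • x + b • y)) ≤
      Real.exp (a * A + b * B) * (a * Real.exp (f k x - A) + b * Real.exp (f k y - B)) := by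
    intro k hk
    calc Real.exp (f k (a • x + b • y))
        ≤ Real.exp ((a * A + b * B) + (a * (f k x - A) + b * (f k y - B))) := by
          have h := (hf k hk).2 hx hy ha hb hab
          simp only [smul_eq_mul] at h
          exact Real.exp_le_exp.2 (by linarith)
      _ ≤ _ := by
          rw [Real.exp_add]
          exact mul_le_mul_of_nonneg_left
            (convexOn_exp.2 (Set.mem_univ _) (Set.mem_univ _) ha hb hab) (Real.exp_pos _).le
  rw [Real.log_le_iff_le_exp (hpos _)]
  refine (Finset.sum_le_sum hterm).trans_eq ?_
  rw [← Finset.mul_sum, Finset.sum_add_distrib, ← Finset.mul_sum, ← Finset.mul_sum, hsum x,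
    hsum y, mul_one, mul_one, hab, mul_one, smul_eq_mul, smul_eq_mul]

/-- The function `log (1 + exp f)` is convex when `f` is. -/
theorem ConvexOn.log_one_add_exp {f : E → ℝ} (hf : ConvexOn ℝ s f) :
    ConvexOn ℝ s fun x => Real.log (1 + Real.exp (f x)) := by
  have h := ConvexOn.log_sum_exp (t := Finset.univ) (f := ![fun _ => 0, f])
    Finset.univ_nonempty hf.1 (by
      intro k _
      fin_cases k
      · exact convexOn_const 0 hf.1
      · exact hf)
  simpa [Fin.sum_univ_two] using h

/-- A finite sum of concave functions is concave. -/
theorem ConcaveOn.finset_sum {ι : Type*} {t : Finset ι} {f : ι → E → ℝ}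
    (hs : Convex ℝ s) (hf : ∀ k ∈ t, ConcaveOn ℝ s (f k)) :
    ConcaveOn ℝ s fun x => ∑ k ∈ t, f k x := by
  classical
  induction t using Finset.induction_on with
  | empty => simpa using concaveOn_const (0 : ℝ) hs
  | insert i t hi ih =>
    simp_rw [Finset.sum_insert hi]
    exact (hf i (Finset.mem_insert_self i t)).add
      (ih fun k hk => hf k (Finset.mem_insert_of_mem hk))

/-- A weighted Bernoulli log-likelihood is concave in its natural parameter. -/
theorem ConcaveOn.bernoulli_loglik (L : E →ₗ[ℝ] ℝ) {c d : ℝ} (hc : 0 ≤ c) (hd : 0 ≤ d) :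
    ConcaveOn ℝ Set.univ fun x =>
      c * (L x - Real.log (1 + Real.exp (L x))) - d * Real.log (1 + Real.exp (L x)) := by
  have h := (L.convexOn convex_univ).log_one_add_exp
  exact (((L.concaveOn convex_univ).sub h).smul hc).sub (h.smul hd)

/-- A weighted multinomial log-likelihood is concave in its natural parameters. -/
theorem ConcaveOn.multinomial_loglik {ι : Type*} {t : Finset ι} (ht : t.Nonempty)
    (M : E →ₗ[ℝ] ℝ) (L : ι → E →ₗ[ℝ] ℝ) {c : ℝ} (hc : 0 ≤ c) :
    ConcaveOn ℝ Set.univ fun x => c * (M x - Real.log (∑ k ∈ t, Real.exp (L k x))) :=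
  ((M.concaveOn convex_univ).sub (ConvexOn.log_sum_exp ht convex_univ
    fun k _ => (L k).convexOn convex_univ)).smul hc

end LogSumExp

/-- Joint concavity of the E-step objective: for nonnegative coefficients
`R, V, D¹,…,D⁶`, the function `Q` is concave in `(α, β, γ, u, θ)`. -/
theorem Q_concave {n : ℕ} (hn : 1 ≤ n)
    (R : Fin n → ℝ) (V D1 D2 D3 D4 D5 D6 : Fin n → Fin n → ℝ)
    (hR : ∀ i, 0 ≤ R i) (hV : ∀ i j, 0 ≤ V i j)
    (hD1 : ∀ i j, 0 ≤ D1 i j) (hD2 : ∀ i j, 0 ≤ D2 i j)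
    (hD3 : ∀ i j, 0 ≤ D3 i j) (hD4 : ∀ i j, 0 ≤ D4 i j)
    (hD5 : ∀ i j, 0 ≤ D5 i j) (hD6 : ∀ i j, 0 ≤ D6 i j) :
    ConcaveOn ℝ Set.univ (Qfun R V D1 D2 D3 D4 D5 D6) := by
  have : Nonempty (Fin n) := ⟨⟨0, hn⟩⟩
  have hne : (Finset.univ : Finset (Fin n)).Nonempty := Finset.univ_nonempty
  let P := ℝ × ℝ × ℝ × (Fin n → ℝ) × (Fin n → Fin n → ℝ)
  let α : P →ₗ[ℝ] ℝ := ⟨⟨fun p => p.1, fun _ _ => rfl⟩, fun _ _ => rfl⟩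
  let β : P →ₗ[ℝ] ℝ := ⟨⟨fun p => p.2.1, fun _ _ => rfl⟩, fun _ _ => rfl⟩
  let γ : P →ₗ[ℝ] ℝ := ⟨⟨fun p => p.2.2.1, fun _ _ => rfl⟩, fun _ _ => rfl⟩
  let u (i : Fin n) : P →ₗ[ℝ] ℝ := ⟨⟨fun p => p.2.2.2.1 i, fun _ _ => rfl⟩, fun _ _ => rfl⟩
  let θ (i j : Fin n) : P →ₗ[ℝ] ℝ :=
    ⟨⟨fun p => p.2.2.2.2 i j, fun _ _ => rfl⟩, fun _ _ => rfl⟩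
  let w (j k : Fin n) : P →ₗ[ℝ] ℝ := u k + if k = j then α else 0
  have hw (j k : Fin n) (p : P) : w j k p = p.2.2.2.1 k + if k = j then p.1 else 0 := by
    by_cases h : k = j <;> simp [w, h, u, α]
  have hinit : ConcaveOn ℝ Set.univ fun p : P =>
      ∑ i, R i * (p.2.2.2.1 i - Real.log (∑ k, Real.exp (p.2.2.2.1 k))) :=
    ConcaveOn.finset_sum convex_univ fun i _ =>
      ConcaveOn.multinomial_loglik hne (u i) u (hR i)
  have hstay : ConcaveOn ℝ Set.univ fun p : P =>
      ∑ i, V i i * (p.2.2.2.1 i + p.1 -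
        Real.log (∑ k, Real.exp (p.2.2.2.1 k + if k = i then p.1 else 0))) := by
    refine ConcaveOn.finset_sum convex_univ fun i _ => ?_
    simp_rw [← hw]
    exact ConcaveOn.multinomial_loglik hne (u i + α) (w i) (hV i i)
  have hmove : ConcaveOn ℝ Set.univ fun p : P =>
      ∑ i, ∑ j ∈ Finset.univ.filter (fun j => j ≠ i), V i j * (p.2.2.2.1 i -
        Real.log (∑ k, Real.exp (p.2.2.2.1 k + if k = j then p.1 else 0))) := by
    refine ConcaveOn.finset_sum convex_univ fun i _ =>
      ConcaveOn.finset_sum convex_univ fun j _ => ?_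
    simp_rw [← hw]
    exact ConcaveOn.multinomial_loglik hne (u i) (w j) (hV i j)
  refine ((hinit.add hstay).add hmove).add
    (ConcaveOn.finset_sum convex_univ fun i _ => ConcaveOn.finset_sum convex_univ fun j _ => ?_)
  refine (((ConcaveOn.bernoulli_loglik (θ i j) (hD1 i j) (hD2 i j)).add
    (ConcaveOn.bernoulli_loglik (θ i j + β) (hD3 i j) (hD4 i j))).add
    (ConcaveOn.bernoulli_loglik (θ i j + γ) (hD5 i j) (hD6 i j))).congr fun p _ => ?_
  simp only [Pi.add_apply, LinearMap.add_apply, θ, β, γ, LinearMap.coe_mk, AddHom.coe_mk]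
  ring
end

section
/- E-step identity: fix an observed group sequence g = (g¹,…,g^T) ∈ ({0,1}^n)^T with P(G = g) > 0. Define R_i^t = P(z^t = i | G = g), V_{ij} = Σ_{t=2}^T P(z^t = i, z^{t−1} = j | G = g), D^1_{ij} = R_i^1 g_j^1 + Σ_{t=2}^T R_i^t(1−g_i^{t−1}) g_j^t, D^2_{ij} = R_i^1(1−g_j^1) + Σ_{t=2}^T R_i^t(1−g_i^{t−1})(1−g_j^t), D^3_{ij} = Σ_{t=2}^T R_i^t g_i^{t−1} g_j^{t−1} g_j^t, D^4_{ij} = Σ_{t=2}^T R_i^t g_i^{t−1} g_j^{t−1}(1−g_j^t), D^5_{ij} = Σ_{t=2}^T R_i^t g_i^{t−1}(1−g_j^{t−1}) g_j^t, and D^6_{ij} = Σ_{t=2}^T R_i^t g_i^{t−1}(1−g_j^{t−1})(1−g_j^t). Then the conditional expectation of the complete log-likelihood given the observed groups satisfies Σ_{z ∈ {1,…,n}^T} P(z | G = g) log P(z, g) = Σ_i R_i^1 log ρ_i + Σ_{i,j} V_{ij} log Φ_{ij} + Σ_{i,j} [D^1_{ij} log A_{ij} + D^2_{ij} log(1−A_{ij})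 + D^3_{ij} log B_{ij} + D^4_{ij} log(1−B_{ij}) + D^5_{ij} log C_{ij} + D^6_{ij} log(1−C_{ij})]. -/
open Finset Real

/-- Index of the previous time point (0-indexed times; `prevIdx t = t - 1`). -/
def prevIdx {T : ℕ} (t : Fin T) : Fin T :=
  ⟨t.val - 1, Nat.lt_of_le_of_lt (Nat.sub_le _ _) t.isLt⟩

/-- Joint probability of a leader sequence `z` and a group sequence `G` (groups are
`{0,1}`-valued vectors, encoded as `ℕ`-valued functions taking values `0` or `1`) under the
temporal-dependent hub model with parameters `ρ, Φ, A, B, C`. -/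
def hubP {n T : ℕ} (hT : 1 ≤ T) (ρ : Fin n → ℝ) (Φ A B C : Fin n → Fin n → ℝ)
    (z : Fin T → Fin n) (G : Fin T → Fin n → ℕ) : ℝ :=
  ρ (z ⟨0, hT⟩) *
    (∏ j, A (z ⟨0, hT⟩) j ^ G ⟨0, hT⟩ j * (1 - A (z ⟨0, hT⟩) j) ^ (1 - G ⟨0, hT⟩ j)) *
    ∏ t : Fin T, if t.val = 0 then 1 else
      Φ (z t) (z (prevIdx t)) *
        (if G (prevIdx t) (z t) = 0 then
          ∏ j, A (z t) j ^ G t j * (1 - A (z t) j) ^ (1 - G t j)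
        else
          ∏ j, (B (z t) j ^ G t j * (1 - B (z t) j) ^ (1 - G t j)) ^ G (prevIdx t) j *
            (C (z t) j ^ G t j * (1 - C (z t) j) ^ (1 - G t j)) ^ (1 - G (prevIdx t) j))

/-- Logarithm of a Bernoulli mass with success probability `a` at the point `k ∈ {0, 1}`. -/
noncomputable def logBernoulli (a : ℝ) (k : ℕ) : ℝ :=
  (k : ℝ) * Real.log a + (1 - (k : ℝ)) * Real.log (1 - a)

/-- Log-likelihood contribution of individual `j` at a time after the first, when the leader
is `i`, the previous group is `h` and the current group is `k`. -/
noncomputable def logTransition {n : ℕ} (A B C : Fin n → Fin n → ℝ) (h k : Fin n → ℕ)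
    (i j : Fin n) : ℝ :=
  (1 - (h i : ℝ)) * logBernoulli (A i j) (k j) +
    (h i : ℝ) * ((h j : ℝ) * logBernoulli (B i j) (k j) +
      (1 - (h j : ℝ)) * logBernoulli (C i j) (k j))

lemma bernoulli_pos {a : ℝ} (ha : 0 < a ∧ a < 1) (k : ℕ) :
    0 < a ^ k * (1 - a) ^ (1 - k) :=
  mul_pos (pow_pos ha.1 _) (pow_pos (sub_pos.2 ha.2) _)

lemma log_bernoulli {a : ℝ} (ha : 0 < a ∧ a < 1) {k : ℕ} (hk : k ≤ 1) :
    Real.log (a ^ k * (1 - a) ^ (1 - k)) = logBernoulli a k := by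
  rw [Real.log_mul (pow_pos ha.1 _).ne' (pow_pos (sub_pos.2 ha.2) _).ne', Real.log_pow,
    Real.log_pow, Nat.cast_sub hk, Nat.cast_one, logBernoulli]

lemma log_hubP {n T : ℕ} (hT : 1 ≤ T)
    (ρ : Fin n → ℝ) (hρ : ∀ i, 0 < ρ i)
    (Φ : Fin n → Fin n → ℝ) (hΦ : ∀ i j, 0 < Φ i j)
    (A B C : Fin n → Fin n → ℝ)
    (hA : ∀ i j, 0 < A i j ∧ A i j < 1)
    (hB : ∀ i j, 0 < B i j ∧ B i j < 1)
    (hC : ∀ i j, 0 < C i j ∧ C i j < 1)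
    (g : Fin T → Fin n → ℕ) (hg : ∀ t j, g t j ≤ 1) (z : Fin T → Fin n) :
    Real.log (hubP hT ρ Φ A B C z g) =
      Real.log (ρ (z ⟨0, hT⟩)) +
      ∑ j, logBernoulli (A (z ⟨0, hT⟩) j) (g ⟨0, hT⟩ j) +
      ∑ t ∈ Finset.univ.filter (fun t : Fin T => t.val ≠ 0),
        (Real.log (Φ (z t) (z (prevIdx t))) +
          ∑ j, logTransition A B C (g (prevIdx t)) (g t) (z t) j) := by
  have hprodA : ∀ (t : Fin T) (i : Fin n),
      0 < ∏ j, A i j ^ g t j * (1 - A i j) ^ (1 - g t j) :=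
    fun t i => Finset.prod_pos fun j _ => bernoulli_pos (hA i j) _
  have hBC : ∀ (t : Fin T) (i j : Fin n),
      0 < (B i j ^ g t j * (1 - B i j) ^ (1 - g t j)) ^ g (prevIdx t) j *
        (C i j ^ g t j * (1 - C i j) ^ (1 - g t j)) ^ (1 - g (prevIdx t) j) :=
    fun t i j => mul_pos (pow_pos (bernoulli_pos (hB i j) _) _)
      (pow_pos (bernoulli_pos (hC i j) _) _)
  have hlogA : ∀ (t : Fin T) (i : Fin n),
      Real.log (∏ j, A i j ^ g t j * (1 - A i j) ^ (1 - g t j)) =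
        ∑ j, logBernoulli (A i j) (g t j) := fun t i => by
    rw [Real.log_prod fun j _ => (bernoulli_pos (hA i j) _).ne']
    exact Finset.sum_congr rfl fun j _ => log_bernoulli (hA i j) (hg t j)
  have hstep : ∀ t : Fin T, 0 < (if g (prevIdx t) (z t) = 0 then
          ∏ j, A (z t) j ^ g t j * (1 - A (z t) j) ^ (1 - g t j)
        else
          ∏ j, (B (z t) j ^ g t j * (1 - B (z t) j) ^ (1 - g t j)) ^ g (prevIdx t) j *
            (C (z t) j ^ g t j * (1 - C (z t) j) ^ (1 - g t j)) ^ (1 - g (prevIdx t) j)) :=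
    fun t => by
      split_ifs
      · exact hprodA t _
      · exact Finset.prod_pos fun j _ => hBC t _ j
  have hlogstep : ∀ t : Fin T, Real.log (if g (prevIdx t) (z t) = 0 then
          ∏ j, A (z t) j ^ g t j * (1 - A (z t) j) ^ (1 - g t j)
        else
          ∏ j, (B (z t) j ^ g t j * (1 - B (z t) j) ^ (1 - g t j)) ^ g (prevIdx t) j *
            (C (z t) j ^ g t j * (1 - C (z t) j) ^ (1 - g t j)) ^ (1 - g (prevIdx t) j)) =
      ∑ j, logTransition A B C (g (prevIdx t)) (g t) (z t) j := fun t => by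
    split_ifs with h
    · simp only [hlogA, logTransition, h, Nat.cast_zero, sub_zero, one_mul, zero_mul, add_zero]
    · have h1 : g (prevIdx t) (z t) = 1 := by
        have := hg (prevIdx t) (z t)
        omega
      rw [Real.log_prod fun j _ => (hBC t _ j).ne']
      refine Finset.sum_congr rfl fun j _ => ?_
      rw [Real.log_mul (pow_pos (bernoulli_pos (hB _ j) _) _).ne'
          (pow_pos (bernoulli_pos (hC _ j) _) _).ne', Real.log_pow, Real.log_pow,
        log_bernoulli (hB _ j) (hg t j), log_bernoulli (hC _ j) (hg t j),
        Nat.cast_sub (hg _ _), logTransition, h1]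
      push_cast
      ring
  have hfactor : ∀ t : Fin T, 0 < Φ (z t) (z (prevIdx t)) * _ :=
    fun t => mul_pos (hΦ _ _) (hstep t)
  have hprod : (∏ t : Fin T, if t.val = 0 then 1 else
      Φ (z t) (z (prevIdx t)) *
        (if g (prevIdx t) (z t) = 0 then
          ∏ j, A (z t) j ^ g t j * (1 - A (z t) j) ^ (1 - g t j)
        else
          ∏ j, (B (z t) j ^ g t j * (1 - B (z t) j) ^ (1 - g t j)) ^ g (prevIdx t) j *
            (C (z t) j ^ g t j * (1 - C (z t) j) ^ (1 - g t j)) ^ (1 - g (prevIdx t) j))) =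
      ∏ t ∈ Finset.univ.filter (fun t : Fin T => t.val ≠ 0), Φ (z t) (z (prevIdx t)) *
        (if g (prevIdx t) (z t) = 0 then
          ∏ j, A (z t) j ^ g t j * (1 - A (z t) j) ^ (1 - g t j)
        else
          ∏ j, (B (z t) j ^ g t j * (1 - B (z t) j) ^ (1 - g t j)) ^ g (prevIdx t) j *
            (C (z t) j ^ g t j * (1 - C (z t) j) ^ (1 - g t j)) ^ (1 - g (prevIdx t) j)) := by
    rw [Finset.prod_filter]
    simp only [ne_eq, ite_not]
  rw [hubP, hprod, Real.log_mul (mul_pos (hρ _) (hprodA _ _)).ne'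
      (Finset.prod_pos fun t _ => hfactor t).ne',
    Real.log_mul (hρ _).ne' (hprodA _ _).ne', hlogA, Real.log_prod fun t _ => (hfactor t).ne']
  congr 1
  refine Finset.sum_congr rfl fun t _ => ?_
  rw [Real.log_mul (hΦ _ _).ne' (hstep t).ne', hlogstep]

/-- A weighted sum of a function of `X` is a sum over the values of `X` against the pushforward
of the (normalized) weights. -/
lemma sum_div_mul_comp {α β : Type*} [Fintype α] [Fintype β] [DecidableEq β]
    (p : α → ℝ) (S : ℝ) (X : α → β) (f : β → ℝ) :
    ∑ a, p a / S * f (X a) = ∑ b, (∑ a, if X a = b then p a else 0) / S * f b := by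
  simp only [Finset.sum_div, Finset.sum_mul]
  rw [Finset.sum_comm]
  refine Finset.sum_congr rfl fun a _ => ?_
  rw [Finset.sum_eq_single (X a)]
  · rw [if_pos rfl]
  · intro b _ hb
    rw [if_neg hb.symm, zero_div, zero_mul]
  · simp

/-- E-step identity: the conditional expectation of the complete log-likelihood given the
observed groups `g` equals
`Σ_i R_i^1 log ρ_i + Σ_{ij} V_{ij} log Φ_{ij} + Σ_{ij} [D¹_{ij} log A_{ij} + D²_{ij} log(1−A_{ij})
 + D³_{ij} log B_{ij} + D⁴_{ij} log(1−B_{ij}) + D⁵_{ij} log C_{ij} + D⁶_{ij} log(1−C_{ij})]`. -/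
theorem E_step_identity
    {n T : ℕ} (hn : 1 ≤ n) (hT : 1 ≤ T)
    (ρ : Fin n → ℝ) (hρ : ∀ i, 0 < ρ i ∧ ρ i < 1) (hρsum : ∑ i, ρ i = 1)
    (Φ : Fin n → Fin n → ℝ) (hΦ : ∀ i j, 0 < Φ i j ∧ Φ i j < 1)
    (hΦsum : ∀ j, ∑ i, Φ i j = 1)
    (A B C : Fin n → Fin n → ℝ)
    (hA : ∀ i j, 0 < A i j ∧ A i j < 1) (hAsym : ∀ i j, A i j = A j i)
    (hB : ∀ i j, 0 < B i j ∧ B i j < 1) (hBsym : ∀ i j, B i j = B j i)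
    (hC : ∀ i j, 0 < C i j ∧ C i j < 1) (hCsym : ∀ i j, C i j = C j i)
    (g : Fin T → Fin n → ℕ) (hg : ∀ t j, g t j ≤ 1)
    (hpos : 0 < ∑ z : Fin T → Fin n, hubP hT ρ Φ A B C z g)
    -- posterior quantities
    (R : Fin T → Fin n → ℝ)
    (hR : ∀ (t : Fin T) (i : Fin n), R t i =
      (∑ z : Fin T → Fin n, if z t = i then hubP hT ρ Φ A B C z g else 0) /
        ∑ z : Fin T → Fin n, hubP hT ρ Φ A B C z g)
    (V : Fin n → Fin n → ℝ)
    (hV : ∀ i j, V i j =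
      ∑ t ∈ Finset.univ.filter (fun t : Fin T => t.val ≠ 0),
        (∑ z : Fin T → Fin n, if z t = i ∧ z (prevIdx t) = j
            then hubP hT ρ Φ A B C z g else 0) /
          ∑ z : Fin T → Fin n, hubP hT ρ Φ A B C z g)
    (D1 D2 D3 D4 D5 D6 : Fin n → Fin n → ℝ)
    (hD1 : ∀ i j, D1 i j = R ⟨0, hT⟩ i * (g ⟨0, hT⟩ j : ℝ) +
      ∑ t ∈ Finset.univ.filter (fun t : Fin T => t.val ≠ 0),
        R t i * (1 - (g (prevIdx t) i : ℝ)) * (g t j : ℝ))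
    (hD2 : ∀ i j, D2 i j = R ⟨0, hT⟩ i * (1 - (g ⟨0, hT⟩ j : ℝ)) +
      ∑ t ∈ Finset.univ.filter (fun t : Fin T => t.val ≠ 0),
        R t i * (1 - (g (prevIdx t) i : ℝ)) * (1 - (g t j : ℝ)))
    (hD3 : ∀ i j, D3 i j =
      ∑ t ∈ Finset.univ.filter (fun t : Fin T => t.val ≠ 0),
        R t i * (g (prevIdx t) i : ℝ) * (g (prevIdx t) j : ℝ) * (g t j : ℝ))
    (hD4 : ∀ i j, D4 i j =
      ∑ t ∈ Finset.univ.filter (fun t : Fin T => t.val ≠ 0),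
        R t i * (g (prevIdx t) i : ℝ) * (g (prevIdx t) j : ℝ) * (1 - (g t j : ℝ)))
    (hD5 : ∀ i j, D5 i j =
      ∑ t ∈ Finset.univ.filter (fun t : Fin T => t.val ≠ 0),
        R t i * (g (prevIdx t) i : ℝ) * (1 - (g (prevIdx t) j : ℝ)) * (g t j : ℝ))
    (hD6 : ∀ i j, D6 i j =
      ∑ t ∈ Finset.univ.filter (fun t : Fin T => t.val ≠ 0),
        R t i * (g (prevIdx t) i : ℝ) * (1 - (g (prevIdx t) j : ℝ)) * (1 - (g t j : ℝ))) :
    (∑ z : Fin T → Fin n,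
        (hubP hT ρ Φ A B C z g / ∑ z' : Fin T → Fin n, hubP hT ρ Φ A B C z' g) *
          Real.log (hubP hT ρ Φ A B C z g)) =
      (∑ i, R ⟨0, hT⟩ i * Real.log (ρ i)) +
      (∑ i, ∑ j, V i j * Real.log (Φ i j)) +
      ∑ i, ∑ j,
        (D1 i j * Real.log (A i j) + D2 i j * Real.log (1 - A i j) +
          D3 i j * Real.log (B i j) + D4 i j * Real.log (1 - B i j) +
          D5 i j * Real.log (C i j) + D6 i j * Real.log (1 - C i j)) := by
  have hexp : ∀ (t : Fin T) (f : Fin n → ℝ),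
      ∑ z : Fin T → Fin n,
        (hubP hT ρ Φ A B C z g / ∑ z' : Fin T → Fin n, hubP hT ρ Φ A B C z' g) * f (z t) =
      ∑ i, R t i * f i := fun t f => by
    rw [sum_div_mul_comp (fun z => hubP hT ρ Φ A B C z g) _ (fun z => z t) f]
    simp only [hR]
  have hVexp : ∑ i, ∑ j, V i j * Real.log (Φ i j) =
      ∑ t ∈ Finset.univ.filter (fun t : Fin T => t.val ≠ 0), ∑ z : Fin T → Fin n,
        (hubP hT ρ Φ A B C z g / ∑ z' : Fin T → Fin n, hubP hT ρ Φ A B C z' g) *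
          Real.log (Φ (z t) (z (prevIdx t))) := by
    rw [← Fintype.sum_prod_type' (fun i j => V i j * Real.log (Φ i j))]
    simp only [hV]
    simp_rw [Finset.sum_mul]
    rw [Finset.sum_comm]
    refine Finset.sum_congr rfl fun t _ => ?_
    rw [sum_div_mul_comp (fun z => hubP hT ρ Φ A B C z g) _
      (fun z => (z t, z (prevIdx t))) (fun x => Real.log (Φ x.1 x.2))]
    simp only [Prod.ext_iff]
  have hDexp : ∀ i j, D1 i j * Real.log (A i j) + D2 i j * Real.log (1 - A i j) +
          D3 i j * Real.log (B i j) + D4 i j * Real.log (1 - B i j) +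
          D5 i j * Real.log (C i j) + D6 i j * Real.log (1 - C i j) =
      R ⟨0, hT⟩ i * logBernoulli (A i j) (g ⟨0, hT⟩ j) +
        ∑ t ∈ Finset.univ.filter (fun t : Fin T => t.val ≠ 0),
          R t i * logTransition A B C (g (prevIdx t)) (g t) i j := fun i j => by
    have hsplit : ∀ t : Fin T, R t i * logTransition A B C (g (prevIdx t)) (g t) i j =
        R t i * (1 - (g (prevIdx t) i : ℝ)) * (g t j : ℝ) * Real.log (A i j) +
        R t i * (1 - (g (prevIdx t) i : ℝ)) * (1 - (g t j : ℝ)) * Real.log (1 - A i j) +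
        R t i * (g (prevIdx t) i : ℝ) * (g (prevIdx t) j : ℝ) * (g t j : ℝ) *
          Real.log (B i j) +
        R t i * (g (prevIdx t) i : ℝ) * (g (prevIdx t) j : ℝ) * (1 - (g t j : ℝ)) *
          Real.log (1 - B i j) +
        R t i * (g (prevIdx t) i : ℝ) * (1 - (g (prevIdx t) j : ℝ)) * (g t j : ℝ) *
          Real.log (C i j) +
        R t i * (g (prevIdx t) i : ℝ) * (1 - (g (prevIdx t) j : ℝ)) * (1 - (g t j : ℝ)) *
          Real.log (1 - C i j) := fun t => by
      simp only [logTransition, logBernoulli]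
      ring
    rw [Finset.sum_congr rfl fun t _ => hsplit t]
    simp only [Finset.sum_add_distrib, ← Finset.sum_mul]
    rw [hD1, hD2, hD3, hD4, hD5, hD6, logBernoulli]
    ring
  have hDsum : ∑ i, ∑ j, (R ⟨0, hT⟩ i * logBernoulli (A i j) (g ⟨0, hT⟩ j) +
        ∑ t ∈ Finset.univ.filter (fun t : Fin T => t.val ≠ 0),
          R t i * logTransition A B C (g (prevIdx t)) (g t) i j) =
      ∑ i, R ⟨0, hT⟩ i * ∑ j, logBernoulli (A i j) (g ⟨0, hT⟩ j) +
        ∑ t ∈ Finset.univ.filter (fun t : Fin T => t.val ≠ 0),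
          ∑ i, R t i * ∑ j, logTransition A B C (g (prevIdx t)) (g t) i j := by
    simp only [Finset.sum_add_distrib, Finset.mul_sum]
    congr 1
    rw [Finset.sum_comm (s := Finset.univ.filter (fun t : Fin T => t.val ≠ 0))]
    exact Finset.sum_congr rfl fun i _ => Finset.sum_comm
  simp only [hDexp]
  rw [hDsum, hVexp, ← hexp, ← hexp ⟨0, hT⟩ fun i => ∑ j, logBernoulli (A i j) (g ⟨0, hT⟩ j)]
  simp only [← hexp _ fun i => ∑ j, logTransition A B C _ _ i j]
  simp only [log_hubP hT ρ (fun i => (hρ i).1) Φ (fun i j => (hΦ i j).1) A B C hA hB hC g hg,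
    mul_add, Finset.sum_add_distrib]
  simp only [Finset.mul_sum (Finset.univ.filter (fun t : Fin T => t.val ≠ 0))]
  rw [Finset.sum_comm (s := Finset.univ.filter (fun t : Fin T => t.val ≠ 0)),
    Finset.sum_comm (s := Finset.univ.filter (fun t : Fin T => t.val ≠ 0))]
  ring
end
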